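/- arXiv:1502.04768 — 8 statements merged into one kernel-verified Lean document; each statement's English description precedes it below -/
import Mathlib

section
/- Let Q be a group and Z an additive abelian group with a right Q-action by additive automorphisms. For every function f : Q → Z, define (δ₁f)(x,y) = f(y) − f(xy) + f(x)·y, and for every function F : Q × Q → Z define the left-Bol differential (δ₂F)(w,x,y,z) = F(w·(xy), z) + F(w, xy)·z + F(x,y)·z − F(w, x·(yz)) − F(x, yz) − F(y,z). Then δ₂(δ₁f) = 0 identically, i.e. (δ₂(δ₁f))(w,x,y,z) = 0 for all w,x,y,z ∈ Q. -/
/-- For a group `Q` and an abelian group `Z` with a right `Q`-action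
by additive automorphisms, the composition of the one-dimensional differential
with the left-Bol differential vanishes identically. -/
theorem stmt0 {Q : Type*} [Group Q] {Z : Type*} [AddCommGroup Z]
    (act : Z → Q → Z)
    (hadd : ∀ z w : Z, ∀ a : Q, act (z + w) a = act z a + act w a)
    (hact_mul : ∀ z : Z, ∀ a b : Q, act (act z a) b = act z (a * b))
    (hact_one : ∀ z : Z, act z 1 = z)
    (f : Q → Z)
    (d₁f : Q → Q → Z)
    (hd₁ : ∀ x y : Q, d₁f x y = f y - f (x * y) + act (f x) y) :
    ∀ w x y z : Q,
      d₁f (w * (x * y)) z + act (d₁f w (x * y)) z + act (d₁f x y) z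
        - d₁f w (x * (y * z)) - d₁f x (y * z) - d₁f y z = 0 := by
  have hsub : ∀ (z w : Z) (a : Q), act (z - w) a = act z a - act w a := fun z w a => by
    rw [eq_sub_iff_add_eq, ← hadd, sub_add_cancel]
  intro w x y z
  simp only [hd₁, hadd, hsub, hact_mul, mul_assoc]
  abel
end

section
/- Let Q be a group, Z an additive abelian group with a right Q-action by additive automorphisms, and f : Q × Q → Z a normalized function. Define a product on Q × Z by (a,w)·(b,z) = (ab, f(a,b) + w·b + z). Then the left-Bol-type identity q·(p·(q·r)) = (q·(p·q))·r holds for all p, q, r ∈ Q × Z if and only if f satisfies the cocycle condition f(y·(xy), z) + f(y, xy)·z + f(x,y)·z = f(y, x·(yz)) + f(x, yz) + f(y,z) for all x, y, z ∈ Q. -/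
/-- The Cartesian-product extension satisfies the left Bol identity
iff the set of factors is a cocycle for the left-Bol differential. -/
theorem stmt2 {Q : Type*} [Group Q] {Z : Type*} [AddCommGroup Z]
    (act : Z → Q → Z)
    (hadd : ∀ z w : Z, ∀ a : Q, act (z + w) a = act z a + act w a)
    (hact_mul : ∀ z : Z, ∀ a b : Q, act (act z a) b = act z (a * b))
    (hact_one : ∀ z : Z, act z 1 = z)
    (f : Q × Q → Z)
    (hf : ∀ a : Q, f (a, 1) = 0 ∧ f (1, a) = 0)
    (mul : Q × Z → Q × Z → Q × Z)
    (hmul : ∀ (a b : Q) (w z : Z), mul (a, w) (b, z) = (a * b, f (a, b) + act w b + z)) :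
    (∀ p q r : Q × Z, mul q (mul p (mul q r)) = mul (mul q (mul p q)) r) ↔
    (∀ x y z : Q,
      f (y * (x * y), z) + act (f (y, x * y)) z + act (f (x, y)) z =
        f (y, x * (y * z)) + f (x, y * z) + f (y, z)) := by
  have bol_iff : ∀ (x y z : Q) (v u t : Z),
      mul (y, u) (mul (x, v) (mul (y, u) (z, t))) =
          mul (mul (y, u) (mul (x, v) (y, u))) (z, t) ↔
        f (y * (x * y), z) + act (f (y, x * y)) z + act (f (x, y)) z =
          f (y, x * (y * z)) + f (x, y * z) + f (y, z) := by
    intro x y z v u t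
    simp only [hmul, hadd, hact_mul, Prod.mk.injEq, mul_assoc, true_and]
    constructor <;> intro h
    · rw [← sub_eq_zero] at h ⊢
      rw [← neg_eq_zero, ← h]
      abel
    · rw [← sub_eq_zero] at h ⊢
      rw [← neg_eq_zero, ← h]
      abel
  exact ⟨fun h x y z => (bol_iff x y z 0 0 0).1 (h (x, 0) (y, 0) (z, 0)),
    fun h p q r => (bol_iff p.1 q.1 r.1 p.2 q.2 r.2).2 (h p.1 q.1 r.1)⟩
end

section
/- Let Q be a group, Z an additive abelian group with a right Q-action by additive automorphisms, and f, g : Q × Q → Z normalized functions. Equip Q × Z with the product ∗_g given by (a,w) ∗_g (b,z) = (ab, g(a,b) + w·b + z) and with the product ∗_f given by (a,w) ∗_f (b,z) = (ab, f(a,b) + w·b + z). Suppose φ : Q × Z → Q × Z satisfies φ(p ∗_g q) = φ(p) ∗_f φ(q) for all p,q, φ(1,z) = (1,z) for all z ∈ Z, and the first coordinate of φ(a,z) equals a for all (a,z). Then there exists h : Q → Z with h(1) = 0 such that g(x,y) − f(x,y) = h(y) − h(xy) + h(x)·y for all x, y ∈ Q, i.e. g − f is a coboundary. -/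
/-- If two Cartesian-product loop extensions given by normalized sets
of factors `g` and `f` are equivalent, then `g - f` is a coboundary. -/
theorem stmt3 {Q : Type*} [Group Q] {Z : Type*} [AddCommGroup Z]
    (act : Z → Q → Z)
    (hadd : ∀ z w : Z, ∀ a : Q, act (z + w) a = act z a + act w a)
    (hact_mul : ∀ z : Z, ∀ a b : Q, act (act z a) b = act z (a * b))
    (hact_one : ∀ z : Z, act z 1 = z)
    (f g : Q × Q → Z)
    (hf : ∀ a : Q, f (a, 1) = 0 ∧ f (1, a) = 0)
    (hg : ∀ a : Q, g (a, 1) = 0 ∧ g (1, a) = 0)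
    (mulf mulg : Q × Z → Q × Z → Q × Z)
    (hmulf : ∀ (a b : Q) (w z : Z), mulf (a, w) (b, z) = (a * b, f (a, b) + act w b + z))
    (hmulg : ∀ (a b : Q) (w z : Z), mulg (a, w) (b, z) = (a * b, g (a, b) + act w b + z))
    (φ : Q × Z → Q × Z)
    (hφ_hom : ∀ p q : Q × Z, φ (mulg p q) = mulf (φ p) (φ q))
    (hφ_Z : ∀ z : Z, φ (1, z) = (1, z))
    (hφ_fst : ∀ (a : Q) (z : Z), (φ (a, z)).1 = a) :
    ∃ h : Q → Z, h 1 = 0 ∧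
      ∀ x y : Q, g (x, y) - f (x, y) = h y - h (x * y) + act (h x) y := by
  have act_zero (a : Q) : act 0 a = 0 := by simpa using hadd 0 0 a
  have φ_zero (a : Q) : φ (a, 0) = (a, (φ (a, 0)).2) := Prod.ext (hφ_fst a 0) rfl
  have φ_apply (a : Q) (z : Z) : φ (a, z) = (a, (φ (a, 0)).2 + z) := by
    have key := hφ_hom (a, 0) (1, z)
    rw [hφ_Z, φ_zero a, hmulf, hmulg] at key
    simpa [(hf a).1, (hg a).1, act_zero, hact_one] using key
  refine ⟨fun a => (φ (a, 0)).2, by simp [hφ_Z], fun x y => ?_⟩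
  have key := hφ_hom (x, 0) (y, 0)
  rw [hmulg, act_zero, add_zero, add_zero, φ_apply, φ_zero x, φ_zero y, hmulf] at key
  have key₂ := congrArg Prod.snd key
  dsimp only at key₂ ⊢
  rw [sub_eq_iff_eq_add, eq_sub_of_add_eq' key₂]
  abel
end

section
/- Let f : ZMod 3 × ZMod 3 → ZMod 2 be normalized, i.e. f(x,0) = f(0,x) = 0 for all x. Define the left Bol differential for trivial action by (δf)(x,y,z) = f(x+2y, z) + f(y, x+y) + f(x,y) − f(y, x+y+z) − f(x, y+z) − f(y,z). Then δf = 0 (i.e. (δf)(x,y,z) = 0 for all x,y,z ∈ ZMod 3) if and only if f(y,y) = f(y,−y) − f(2y,−y) for all y ∈ ZMod 3. -/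
/-- For a normalized `f : ZMod 3 × ZMod 3 → ZMod 2`, the left Bol
cocycle condition (trivial action) is equivalent to the diagonal condition
`f(y,y) = f(y,-y) - f(2y,-y)`. -/
theorem stmt6 (f : ZMod 3 × ZMod 3 → ZMod 2)
    (hnorm : ∀ x : ZMod 3, f (x, 0) = 0 ∧ f (0, x) = 0) :
    (∀ x y z : ZMod 3,
      f (x + 2 * y, z) + f (y, x + y) + f (x, y)
        - f (y, x + y + z) - f (x, y + z) - f (y, z) = 0) ↔
    (∀ y : ZMod 3, f (y, y) = f (y, -y) - f (2 * y, -y)) := by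
  constructor
  · intro h y
    have hy := h 0 y (-y)
    simp only [zero_add, add_neg_cancel, (hnorm _).1, (hnorm _).2] at hy
    linear_combination hy
  · intro h
    have h₀ : ∀ x, f (x, 0) = 0 := fun x => (hnorm x).1
    have h₀' : ∀ x, f (0, x) = 0 := fun x => (hnorm x).2
    have h₁ : f (1, 1) = f (1, 2) - f (2, 2) := h 1
    have h₂ : f (2, 2) = f (2, 1) - f (1, 1) := h 2
    have h₁₂ : f (1, 2) = f (1, 1) + f (2, 2) := by linear_combination -h₁
    have h₂₁ : f (2, 1) = f (1, 1) + f (2, 2) := by linear_combination -h₂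
    have hf : ∀ x y, f (x, y) =
        if x = 0 ∨ y = 0 then 0 else if x = y then f (x, x) else f (1, 1) + f (2, 2) := by
      intro x y
      fin_cases x <;> fin_cases y
      · exact h₀ 0
      · exact h₀' 1
      · exact h₀' 2
      · exact h₀ 1
      · rfl
      · exact h₁₂
      · exact h₀ 2
      · exact h₂₁
      · rfl
    have hd : ∀ x, f (x, x) = if x = 0 then 0 else if x = 1 then f (1, 1) else f (2, 2) := by
      intro x
      fin_cases x
      · exact h₀ 0
      · rfl
      · rfl
    generalize f (1, 1) = a at hf hd
    generalize f (2, 2) = b at hf hd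
    simp only [hd] at hf
    simp only [hf]
    clear * -
    decide +revert
end

section
/- The set of normalized functions f : ZMod 3 × ZMod 3 → ZMod 2 satisfying (δf)(x,y,z) = 0 for all x, y, z ∈ ZMod 3, where (δf)(x,y,z) = f(x+2y, z) + f(y, x+y) + f(x,y) − f(y, x+y+z) − f(x, y+z) − f(y,z), has exactly 4 elements. -/
/-- The normalized function with value `p.1` at `(1, 1)`, `p.2` at `(1, 2)` and `(2, 1)`, and
`p.1 + p.2` at `(2, 2)`. -/
def bolCocycle (p : ZMod 2 × ZMod 2) (v : ZMod 3 × ZMod 3) : ZMod 2 :=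
  if v = (1, 1) then p.1
  else if v = (1, 2) ∨ v = (2, 1) then p.2
  else if v = (2, 2) then p.1 + p.2
  else 0

theorem bolCocycle_injective : Function.Injective bolCocycle := fun _ _ h =>
  Prod.ext (congrFun h (1, 1)) (congrFun h (1, 2))

/-- The kernel of the left Bol differential (trivial action) on
normalized functions `ZMod 3 × ZMod 3 → ZMod 2` has exactly 4 elements. -/
theorem stmt7 :
    Set.ncard {f : ZMod 3 × ZMod 3 → ZMod 2 |
      (∀ x : ZMod 3, f (x, 0) = 0 ∧ f (0, x) = 0) ∧
      ∀ x y z : ZMod 3,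
        f (x + 2 * y, z) + f (y, x + y) + f (x, y)
          - f (y, x + y + z) - f (x, y + z) - f (y, z) = 0} = 4 := by
  have h_range : {f : ZMod 3 × ZMod 3 → ZMod 2 |
      (∀ x : ZMod 3, f (x, 0) = 0 ∧ f (0, x) = 0) ∧
      ∀ x y z : ZMod 3,
        f (x + 2 * y, z) + f (y, x + y) + f (x, y)
          - f (y, x + y + z) - f (x, y + z) - f (y, z) = 0} = Set.range bolCocycle := by
    ext f
    constructor
    · rintro ⟨h_norm, h_bol⟩
      have h_symm : f (2, 1) = f (1, 2) := by
        have h : f (2, 1) + f (1, 1) + f (0, 1) - f (1, 2) - f (0, 2) - f (1, 1) = 0 :=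
          h_bol 0 1 1
        rw [(h_norm 1).2, (h_norm 2).2] at h
        linear_combination h
      have h_sum : f (2, 2) = f (1, 1) + f (1, 2) := by
        have h : f (2, 2) + f (1, 1) + f (0, 1) - f (1, 0) - f (0, 0) - f (1, 2) = 0 :=
          h_bol 0 1 2
        rw [(h_norm 1).2, (h_norm 1).1, (h_norm 0).1] at h
        linear_combination h - CharTwo.add_self_eq_zero (f (1, 1))
      refine ⟨(f (1, 1), f (1, 2)), funext fun ⟨x, y⟩ => ?_⟩
      fin_cases x <;> fin_cases y
      exacts [(h_norm 0).1.symm, (h_norm 1).2.symm, (h_norm 2).2.symm, (h_norm 1).1.symm, rfl, rfl,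
        (h_norm 2).1.symm, h_symm.symm, h_sum.symm]
    · rintro ⟨p, rfl⟩
      revert p
      simp only [Set.mem_ofPred_eq]
      decide
  rw [h_range, ← Set.image_univ, Set.ncard_image_of_injective _ bolCocycle_injective,
    Set.ncard_univ]
  simp
end

section
/- Every normalized function f : ZMod 3 × ZMod 3 → ZMod 2 satisfying (δf)(x,y,z) = 0 for all x, y, z ∈ ZMod 3, where (δf)(x,y,z) = f(x+2y, z) + f(y, x+y) + f(x,y) − f(y, x+y+z) − f(x, y+z) − f(y,z), is a coboundary: there exists h : ZMod 3 → ZMod 2 with h(0) = 0 such that f(x,y) = h(y) − h(x+y) + h(x) for all x, y ∈ ZMod 3. Consequently the cohomology group H²_δ(ZMod 3, ZMod 2) for the left Bol differential with trivial action is trivial. -/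
/-- Every normalized left Bol cocycle `ZMod 3 × ZMod 3 → ZMod 2`
(trivial action) is a coboundary, i.e. `H²_δ(ZMod 3, ZMod 2)` is trivial. -/
theorem stmt9 (f : ZMod 3 × ZMod 3 → ZMod 2)
    (hnorm : ∀ x : ZMod 3, f (x, 0) = 0 ∧ f (0, x) = 0)
    (hcocycle : ∀ x y z : ZMod 3,
      f (x + 2 * y, z) + f (y, x + y) + f (x, y)
        - f (y, x + y + z) - f (x, y + z) - f (y, z) = 0) :
    ∃ h : ZMod 3 → ZMod 2, h 0 = 0 ∧
      ∀ x y : ZMod 3, f (x, y) = h y - h (x + y) + h x := by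
  have h21 := hcocycle 1 2 1
  have h22 := hcocycle 1 2 2
  have r1 : (1 + 2 * 2 : ZMod 3) = 2 := by decide
  have r2 : (1 + 2 : ZMod 3) = 0 := by decide
  have r3 : (2 + 1 : ZMod 3) = 0 := by decide
  have r4 : (2 + 2 : ZMod 3) = 1 := by decide
  have r5 : (1 + 1 : ZMod 3) = 2 := by decide
  have n1 : (-1 : ZMod 3) = 2 := by decide
  have n2 : (-2 : ZMod 3) = 1 := by decide
  simp only [r1, r2, r3, r4, zero_add, (hnorm _).1] at h21 h22
  refine ⟨fun x => f (-x, -x), by simp [(hnorm 0).1], fun x y => ?_⟩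
  have key : ∀ a b c d : ZMod 2, c + 0 + b - c - 0 - c = 0 → d + 0 + b - d - a - d = 0 →
      a = d - a + d ∧ b = a - 0 + d ∧ c = d - 0 + a ∧ d = a - d + a := by decide
  obtain ⟨k11, k12, k21, k22⟩ := key _ _ _ _ h21 h22
  have cases_three : ∀ x : ZMod 3, x = 0 ∨ x = 1 ∨ x = 2 := by decide
  rcases cases_three x with rfl | rfl | rfl <;> rcases cases_three y with rfl | rfl | rfl <;>
    simp only [r2, r3, r4, r5, n1, n2, neg_zero, zero_add, add_zero, sub_self,
      (hnorm _).1, (hnorm _).2] <;>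
    first | assumption | abel
end

section
/- Let f, g : ZMod 3 × ZMod 3 → ZMod 2 be normalized functions each satisfying the left Bol cocycle condition (δf)(x,y,z) = 0 and (δg)(x,y,z) = 0 for all x,y,z, where (δf)(x,y,z) = f(x+2y, z) + f(y, x+y) + f(x,y) − f(y, x+y+z) − f(x, y+z) − f(y,z). Equip ZMod 3 × ZMod 2 with the two products (a,w) ∗_f (b,z) = (a+b, f(a,b) + w + z) and (a,w) ∗_g (b,z) = (a+b, g(a,b) + w + z). Then the two loop extensions are equivalent: there exists h : ZMod 3 → ZMod 2 with h(0) = 0 such that the bijection φ(a,z) = (a, z + h(a)) satisfies φ(p ∗_g q) = φ(p) ∗_f φ(q) for all p, q ∈ ZMod 3 × ZMod 2. -/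
/-- Every normalized left Bol cocycle on `ZMod 3` with values in `ZMod 2` is the coboundary of
`a ↦ f (-a, -a)`. -/
lemma bol_cocycle_eq_coboundary (f : ZMod 3 × ZMod 3 → ZMod 2)
    (hnorm : ∀ x : ZMod 3, f (x, 0) = 0 ∧ f (0, x) = 0)
    (hcocycle : ∀ x y z : ZMod 3,
      f (x + 2 * y, z) + f (y, x + y) + f (x, y)
        - f (y, x + y + z) - f (x, y + z) - f (y, z) = 0) (a b : ZMod 3) :
    f (a, b) = f (-a, -a) + f (-b, -b) + f (-(a + b), -(a + b)) := by
  have hx := fun x => (hnorm x).1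
  have h0 := fun x => (hnorm x).2
  have h₁ : f (2, 1) + f (2, 0) + f (1, 2) - f (2, 1) - f (1, 0) - f (2, 1) = 0 :=
    hcocycle 1 2 1
  have h₂ : f (2, 2) + f (2, 0) + f (1, 2) - f (2, 2) - f (1, 1) - f (2, 2) = 0 :=
    hcocycle 1 2 2
  simp only [hx] at h₁ h₂
  have key : ∀ p q r s : ZMod 2, q + 0 + p - q - 0 - q = 0 → s + 0 + p - s - r - s = 0 →
      p = r + s ∧ q = r + s := by decide
  obtain ⟨h₁₂, h₂₁⟩ := key _ _ _ _ h₁ h₂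
  have n₁ : -(1 : ZMod 3) = 2 := rfl
  have n₂ : -(2 : ZMod 3) = 1 := rfl
  have s₁₁ : (1 : ZMod 3) + 1 = 2 := rfl
  have s₁₂ : (1 : ZMod 3) + 2 = 0 := rfl
  have s₂₁ : (2 : ZMod 3) + 1 = 0 := rfl
  have s₂₂ : (2 : ZMod 3) + 2 = 1 := rfl
  have cases3 : ∀ x : ZMod 3, x = 0 ∨ x = 1 ∨ x = 2 := by decide
  rcases cases3 a with rfl | rfl | rfl <;> rcases cases3 b with rfl | rfl | rfl <;>
    simp only [n₁, n₂, s₁₁, s₁₂, s₂₁, s₂₂, h₁₂, h₂₁, hx, h0, neg_zero, add_zero, zero_add,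
      CharTwo.add_self_eq_zero, add_comm (f (1, 1))]


/-- Any two left Bol metacyclic extensions of `ZMod 3` by `ZMod 2`
with trivial action are equivalent. -/
theorem stmt10 (f g : ZMod 3 × ZMod 3 → ZMod 2)
    (hfnorm : ∀ x : ZMod 3, f (x, 0) = 0 ∧ f (0, x) = 0)
    (hgnorm : ∀ x : ZMod 3, g (x, 0) = 0 ∧ g (0, x) = 0)
    (hfcocycle : ∀ x y z : ZMod 3,
      f (x + 2 * y, z) + f (y, x + y) + f (x, y)
        - f (y, x + y + z) - f (x, y + z) - f (y, z) = 0)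
    (hgcocycle : ∀ x y z : ZMod 3,
      g (x + 2 * y, z) + g (y, x + y) + g (x, y)
        - g (y, x + y + z) - g (x, y + z) - g (y, z) = 0)
    (mulf mulg : ZMod 3 × ZMod 2 → ZMod 3 × ZMod 2 → ZMod 3 × ZMod 2)
    (hmulf : ∀ (a b : ZMod 3) (w z : ZMod 2),
      mulf (a, w) (b, z) = (a + b, f (a, b) + w + z))
    (hmulg : ∀ (a b : ZMod 3) (w z : ZMod 2),
      mulg (a, w) (b, z) = (a + b, g (a, b) + w + z)) :
    ∃ h : ZMod 3 → ZMod 2, h 0 = 0 ∧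
      ∀ p q : ZMod 3 × ZMod 2,
        (fun r : ZMod 3 × ZMod 2 => (r.1, r.2 + h r.1)) (mulg p q) =
          mulf ((fun r : ZMod 3 × ZMod 2 => (r.1, r.2 + h r.1)) p)
               ((fun r : ZMod 3 × ZMod 2 => (r.1, r.2 + h r.1)) q) := by
  refine ⟨fun a => f (-a, -a) + g (-a, -a), ?_, ?_⟩
  · simp [(hfnorm 0).1, (hgnorm 0).1]
  · rintro ⟨a, w⟩ ⟨b, z⟩
    simp only [hmulf, hmulg, Prod.mk.injEq, true_and]
    rw [bol_cocycle_eq_coboundary f hfnorm hfcocycle a b,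
      bol_cocycle_eq_coboundary g hgnorm hgcocycle a b]
    linear_combination CharTwo.add_self_eq_zero (g (-(a + b), -(a + b))) -
      CharTwo.add_self_eq_zero (f (-a, -a)) - CharTwo.add_self_eq_zero (f (-b, -b))
end

section
/- Let n, m be positive integers with n ≥ 2. On the set of normalized symmetric functions f : ZMod n × ZMod n → ZMod m, consider the equivalence relation f ∼ g if and only if there exists h : ZMod n → ZMod m with h(0) = 0 such that g(x,y) − f(x,y) = h(y) − h(x+y) + h(x) for all x, y. Then the number of equivalence classes equals gcd(n,m) · m^((n−1)(n−2)/2). (These classes are in one-to-one correspondence with equivalence classes of commutative loop extensions of ZMod n by ZMod m with trivial action.) -/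
/-- The group of normalized symmetric functions `G × G → A`. -/
def normalizedSymmetric (G A : Type*) [AddCommGroup G] [AddCommGroup A] :
    AddSubgroup (G × G → A) where
  carrier := {f | (∀ x : G, f (x, 0) = 0 ∧ f (0, x) = 0) ∧ ∀ x y : G, f (x, y) = f (y, x)}
  zero_mem' := by simp
  add_mem' := by
    rintro f g ⟨hf, hf'⟩ ⟨hg, hg'⟩
    exact ⟨fun x => by simp [hf x, hg x], fun x y => by simp [hf' x y, hg' x y]⟩
  neg_mem' := by
    rintro f ⟨hf, hf'⟩
    exact ⟨fun x => by simp [hf x], fun x y => by simp [hf' x y]⟩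

/-- The group of functions `G → A` vanishing at `0`. -/
def normalizedCochain (G A : Type*) [AddCommGroup G] [AddCommGroup A] : AddSubgroup (G → A) :=
  (Pi.evalAddMonoidHom (fun _ : G => A) 0).ker

section

variable {G A : Type*} [AddCommGroup G] [AddCommGroup A]

variable (G A) in
/-- The one-dimensional differential for the trivial action. -/
def differential : normalizedCochain G A →+ normalizedSymmetric G A where
  toFun h := ⟨fun p => h.1 p.2 - h.1 (p.1 + p.2) + h.1 p.1, by
    have h0 : h.1 0 = 0 := h.2
    exact ⟨fun x => by simp [h0], fun x y => by simp only [add_comm x y]; abel⟩⟩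
  map_zero' := by ext; simp
  map_add' h k := by
    ext p
    simp only [AddSubgroup.coe_add, Pi.add_apply]
    abel

theorem differential_apply (h : normalizedCochain G A) (x y : G) :
    (differential G A h).1 (x, y) = h.1 y - h.1 (x + y) + h.1 x := rfl

variable (G A) in
/-- The kernel of the differential consists of the additive homomorphisms. -/
def differentialKerEquiv : (differential G A).ker ≃ (G →+ A) where
  toFun h :=
    { toFun := h.1.1
      map_zero' := h.1.2
      map_add' := fun x y => by
        have hxy : h.1.1 y - h.1.1 (x + y) + h.1.1 x = 0 := by
          rw [← differential_apply, h.2]; rfl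
        rw [← sub_eq_zero, ← neg_eq_zero, ← hxy]
        abel }
  invFun φ := ⟨⟨φ, φ.map_zero⟩, by
    ext p
    change φ p.2 - φ (p.1 + p.2) + φ p.1 = 0
    rw [map_add]
    abel⟩
  left_inv _ := rfl
  right_inv _ := rfl

open Classical in
variable (G A) in
/-- A normalized symmetric function is a function on unordered pairs of nonzero elements. -/
noncomputable def normalizedSymmetricEquiv :
    normalizedSymmetric G A ≃ (Sym2 {x : G // x ≠ 0} → A) where
  toFun f := Sym2.lift ⟨fun a b => f.1 (a, b), fun a b => f.2.2 a b⟩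
  invFun g := ⟨fun p => if h : p.1 ≠ 0 ∧ p.2 ≠ 0 then g s(⟨p.1, h.1⟩, ⟨p.2, h.2⟩) else 0, by
    refine ⟨fun x => by simp, fun x y => ?_⟩
    by_cases hx : x = 0 <;> by_cases hy : y = 0 <;> simp [hx, hy, Sym2.eq_swap]⟩
  left_inv f := by
    ext ⟨x, y⟩
    by_cases hx : x = 0
    · subst hx; simpa using (f.2.1 y).2.symm
    by_cases hy : y = 0
    · subst hy; simpa using (f.2.1 x).1.symm
    simp [hx, hy]
  right_inv g := by
    ext z
    induction z with
    | _ a b => simp [a.2, b.2]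

variable (G A) in
theorem card_normalizedSymmetric [Finite G] [Finite A] :
    Nat.card (normalizedSymmetric G A) = Nat.card A ^ (Nat.card G).choose 2 := by
  classical
  have := Fintype.ofFinite G
  have hG : 0 < Fintype.card G := Fintype.card_pos
  rw [Nat.card_congr (normalizedSymmetricEquiv G A), Nat.card_fun,
    Nat.card_eq_fintype_card (α := Sym2 _), Sym2.card, Fintype.card_subtype_compl, Fintype.card_subtype_eq, Nat.sub_add_cancel hG,
    Nat.card_eq_fintype_card (α := G)]

variable (G A) in
theorem card_normalizedCochain_mul [Finite G] [Finite A] :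
    Nat.card (normalizedCochain G A) * Nat.card A = Nat.card A ^ Nat.card G := by
  have hs : Function.Surjective (Pi.evalAddMonoidHom (fun _ : G => A) 0) :=
    fun a => ⟨fun _ => a, rfl⟩
  rw [← Nat.card_fun, ← (normalizedCochain G A).card_mul_index, normalizedCochain,
    AddSubgroup.index_ker, AddMonoidHom.range_eq_top.mpr hs, AddSubgroup.card_top]

variable (G A) in
theorem card_quotient_differential_range_mul [Finite G] [Finite A] :
    Nat.card (normalizedSymmetric G A ⧸ (differential G A).range) * Nat.card A ^ Nat.card G =
      Nat.card (G →+ A) * Nat.card A ^ ((Nat.card G).choose 2 + 1) := by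
  have hker := (differential G A).ker.card_mul_index
  rw [AddSubgroup.index_ker, Nat.card_congr (differentialKerEquiv G A)] at hker
  rw [← card_normalizedCochain_mul G A, ← hker, pow_succ, ← card_normalizedSymmetric G A,
    AddSubgroup.card_eq_card_quotient_mul_card_addSubgroup (differential G A).range]
  ring

variable (G A) in
/-- Cohomology classes are the cosets of the range of the differential. -/
def quotEquivQuotientRange :
    Quot (fun f g : normalizedSymmetric G A => ∃ h : G → A, h 0 = 0 ∧
      ∀ x y : G, g.1 (x, y) - f.1 (x, y) = h y - h (x + y) + h x) ≃
    normalizedSymmetric G A ⧸ (differential G A).range :=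
  Quot.congrRight fun f g => by
    rw [QuotientAddGroup.leftRel_apply]
    constructor
    · rintro ⟨h, h0, hh⟩
      refine ⟨⟨h, h0⟩, ?_⟩
      ext ⟨x, y⟩
      exact (hh x y).symm.trans (sub_eq_neg_add _ _)
    · rintro ⟨h, hh⟩
      refine ⟨h.1, h.2, fun x y => ?_⟩
      rw [← differential_apply, hh]
      exact sub_eq_neg_add _ _

end

theorem ZMod.card_addMonoidHom (n : ℕ) (A : Type*) [AddCommGroup A] [Finite A] [IsAddCyclic A] :
    Nat.card (ZMod n →+ A) = (Nat.card A).gcd n := by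
  rw [← IsAddCyclic.card_nsmulAddMonoidHom_ker]
  refine Nat.card_congr ((ZMod.lift n).symm.trans ?_)
  refine ((zmultiplesHom A).symm.subtypeEquiv fun f => ?_)
  have hf : f n = n • f 1 := by simpa using f.map_nsmul n 1
  simp [AddMonoidHom.mem_ker, hf]

theorem Nat.choose_two_add_one_eq {n : ℕ} (hn : 2 ≤ n) :
    n.choose 2 + 1 = (n - 1) * (n - 2) / 2 + n := by
  obtain ⟨k, rfl⟩ := Nat.exists_eq_add_of_le' hn
  have h := Nat.choose_two_right (k + 1)
  have h₁ : (k + 2).choose 2 = (k + 1).choose 1 + (k + 1).choose 2 := Nat.choose_succ_succ _ _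
  rw [Nat.choose_one_right] at h₁
  rw [Nat.add_sub_cancel] at h ⊢
  rw [h₁, h, show k + 2 - 1 = k + 1 from rfl]
  omega

/-- The number of cohomology classes of normalized symmetric
functions `ZMod n × ZMod n → ZMod m` (equivalently, of commutative loop
extensions of `ZMod n` by `ZMod m` with trivial action) is
`gcd(n,m) · m^((n-1)(n-2)/2)`. -/
theorem stmt13 (n m : ℕ) (hn : 2 ≤ n) (hm : 0 < m) :
    Nat.card (Quot (fun f g : {f : ZMod n × ZMod n → ZMod m //
        (∀ x : ZMod n, f (x, 0) = 0 ∧ f (0, x) = 0) ∧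
        ∀ x y : ZMod n, f (x, y) = f (y, x)} =>
      ∃ h : ZMod n → ZMod m, h 0 = 0 ∧
        ∀ x y : ZMod n, g.1 (x, y) - f.1 (x, y) = h y - h (x + y) + h x)) =
    Nat.gcd n m * m ^ ((n - 1) * (n - 2) / 2) := by
  have : NeZero n := ⟨by omega⟩
  have : NeZero m := ⟨hm.ne'⟩
  have e : Nat.card (normalizedSymmetric (ZMod n) (ZMod m) ⧸
      (differential (ZMod n) (ZMod m)).range) = Nat.gcd n m * m ^ ((n - 1) * (n - 2) / 2) := by
    have h := card_quotient_differential_range_mul (ZMod n) (ZMod m)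
    rw [ZMod.card_addMonoidHom, Nat.card_zmod, Nat.card_zmod, Nat.choose_two_add_one_eq hn,
      pow_add, ← mul_assoc, Nat.gcd_comm] at h
    exact Nat.eq_of_mul_eq_mul_right (pow_pos hm n) h
  rw [← e]
  exact Nat.card_congr (quotEquivQuotientRange (ZMod n) (ZMod m))
end
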